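/- arXiv:1703.08852 — 2 statements merged into one kernel-verified Lean document; each statement's English description precedes it below -/
import Mathlib

section
/- Let p, q > 0. For all x₁, y₁, x₂, y₂ > 0 and all c, d ≥ 0 with c + d = 1, the extended (p,q)-beta function satisfies B_{p,q}(c x₁ + d x₂, c y₁ + d y₂) ≤ (B_{p,q}(x₁, y₁))^c · (B_{p,q}(x₂, y₂))^d; that is, the map (x,y) ↦ B_{p,q}(x,y) is log-convex on (0,∞) × (0,∞). -/
/-- The extended `(p,q)`-beta function
`B_{p,q}(x,y) = ∫₀¹ t^(x-1) (1-t)^(y-1) exp(-p/t - q/(1-t)) dt`. -/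
noncomputable def extBeta (p q x y : ℝ) : ℝ :=
  ∫ t in (0:ℝ)..1, t ^ (x - 1) * (1 - t) ^ (y - 1) * Real.exp (-p / t - q / (1 - t))

open MeasureTheory Set

/-- Hölder's inequality for nonnegative integrable functions, with exponents summing to `1`. -/
theorem integral_rpow_mul_rpow_le {α : Type*} [MeasurableSpace α] {μ : Measure α} {f g : α → ℝ}
    (hf : Integrable f μ) (hg : Integrable g μ) (hf0 : 0 ≤ᵐ[μ] f) (hg0 : 0 ≤ᵐ[μ] g)
    {c d : ℝ} (hc : 0 ≤ c) (hd : 0 ≤ d) (hcd : c + d = 1) :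
    ∫ a, f a ^ c * g a ^ d ∂μ ≤ (∫ a, f a ∂μ) ^ c * (∫ a, g a ∂μ) ^ d := by
  have hF : 0 ≤ ∫ a, f a ∂μ := integral_nonneg_of_ae hf0
  have hG : 0 ≤ ∫ a, g a ∂μ := integral_nonneg_of_ae hg0
  rw [integral_eq_lintegral_of_nonneg_ae]
  · refine ENNReal.toReal_le_of_le_ofReal (by positivity) ?_
    rw [ENNReal.ofReal_mul (by positivity), ← ENNReal.ofReal_rpow_of_nonneg hF hc,
      ← ENNReal.ofReal_rpow_of_nonneg hG hd, ofReal_integral_eq_lintegral_ofReal hf hf0,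
      ofReal_integral_eq_lintegral_ofReal hg hg0]
    refine le_of_eq_of_le (lintegral_congr_ae ?_) (ENNReal.lintegral_mul_norm_pow_le
      hf.aemeasurable.ennreal_ofReal hg.aemeasurable.ennreal_ofReal hc hd hcd)
    filter_upwards [hf0, hg0] with a (hfa : 0 ≤ f a) (hga : 0 ≤ g a)
    rw [ENNReal.ofReal_mul (by positivity), ENNReal.ofReal_rpow_of_nonneg hfa hc,
      ENNReal.ofReal_rpow_of_nonneg hga hd]
  · filter_upwards [hf0, hg0] with a (hfa : 0 ≤ f a) (hga : 0 ≤ g a)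
    exact mul_nonneg (Real.rpow_nonneg hfa c) (Real.rpow_nonneg hga d)
  · exact ((hf.aemeasurable.pow_const c).mul (hg.aemeasurable.pow_const d)).aestronglyMeasurable

theorem integrableOn_beta_integrand {x y : ℝ} (hx : 0 < x) (hy : 0 < y) :
    IntegrableOn (fun t : ℝ => t ^ (x - 1) * (1 - t) ^ (y - 1)) (Ioo 0 1) := by
  have h := (intervalIntegrable_iff_integrableOn_Ioo_of_le zero_le_one).mp
    (Complex.betaIntegral_convergent (u := x) (v := y) (by simpa) (by simpa))
  refine IntegrableOn.congr_fun h.norm (fun t ht => ?_) measurableSet_Ioo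
  have h1 : ‖(1 - (t : ℂ)) ^ ((y : ℂ) - 1)‖ = (1 - t) ^ (y - 1) := by
    simpa using Complex.norm_cpow_eq_rpow_re_of_pos (sub_pos.mpr ht.2) ((y : ℂ) - 1)
  simp [h1, Complex.norm_cpow_eq_rpow_re_of_pos ht.1]

theorem integrableOn_extBeta_integrand {p q x y : ℝ} (hp : 0 ≤ p) (hq : 0 ≤ q)
    (hx : 0 < x) (hy : 0 < y) :
    IntegrableOn (fun t : ℝ => t ^ (x - 1) * (1 - t) ^ (y - 1) *
      Real.exp (-p / t - q / (1 - t))) (Ioo 0 1) := by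
  refine (integrableOn_beta_integrand hx hy).mul_bdd (c := 1)
    (Measurable.aestronglyMeasurable (by fun_prop)) ?_
  filter_upwards [self_mem_ae_restrict measurableSet_Ioo] with t ht
  have h1 : 0 ≤ p / t := div_nonneg hp ht.1.le
  have h2 : 0 ≤ q / (1 - t) := div_nonneg hq (sub_pos.mpr ht.2).le
  rw [Real.norm_of_nonneg (Real.exp_pos _).le, Real.exp_le_one_iff, neg_div]
  linarith

theorem extBeta_eq_setIntegral_Ioo (p q x y : ℝ) :
    extBeta p q x y = ∫ t in Ioo (0 : ℝ) 1,
      t ^ (x - 1) * (1 - t) ^ (y - 1) * Real.exp (-p / t - q / (1 - t)) := by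
  rw [extBeta, intervalIntegral.integral_of_le zero_le_one, integral_Ioc_eq_integral_Ioo]

theorem extBeta_logConvex_in_xy (p q : ℝ) (hp : 0 < p) (hq : 0 < q)
    (x₁ y₁ x₂ y₂ : ℝ) (hx₁ : 0 < x₁) (hy₁ : 0 < y₁) (hx₂ : 0 < x₂) (hy₂ : 0 < y₂)
    (c d : ℝ) (hc : 0 ≤ c) (hd : 0 ≤ d) (hcd : c + d = 1) :
    extBeta p q (c * x₁ + d * x₂) (c * y₁ + d * y₂) ≤
      (extBeta p q x₁ y₁) ^ c * (extBeta p q x₂ y₂) ^ d := by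
  have nonneg (x y : ℝ) : 0 ≤ᵐ[volume.restrict (Ioo 0 1)] fun t : ℝ =>
      t ^ (x - 1) * (1 - t) ^ (y - 1) * Real.exp (-p / t - q / (1 - t)) := by
    filter_upwards [self_mem_ae_restrict measurableSet_Ioo] with t ht
    have h0 := ht.1
    have h1 := sub_pos.mpr ht.2
    simp only [Pi.zero_apply]
    positivity
  simp only [extBeta_eq_setIntegral_Ioo]
  refine le_of_eq_of_le (setIntegral_congr_fun measurableSet_Ioo fun t ht => ?_)
    (integral_rpow_mul_rpow_le (integrableOn_extBeta_integrand hp.le hq.le hx₁ hy₁)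
      (integrableOn_extBeta_integrand hp.le hq.le hx₂ hy₂) (nonneg x₁ y₁) (nonneg x₂ y₂) hc hd hcd)
  have h0 : 0 < t := ht.1
  have h1 : 0 < 1 - t := sub_pos.mpr ht.2
  have hd' : d = 1 - c := by linarith
  simp only [Real.rpow_def_of_pos h0, Real.rpow_def_of_pos h1, ← Real.exp_add, ← Real.exp_mul, hd']
  ring_nf
end

section
/- Let p, q > 0 and let β, γ be real numbers with γ > β > 0. Then the function x ↦ Φ_{p,q}(β; γ; x) is log-convex on ℝ; that is, for all real x, y and all α ∈ [0,1], Φ_{p,q}(β; γ; α x + (1−α) y) ≤ (Φ_{p,q}(β; γ; x))^α · (Φ_{p,q}(β; γ; y))^{1−α}. -/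
/-- The classical Euler beta function `B(x,y) = ∫₀¹ t^(x-1) (1-t)^(y-1) dt`. -/
noncomputable def eulerBeta (x y : ℝ) : ℝ :=
  ∫ t in (0:ℝ)..1, t ^ (x - 1) * (1 - t) ^ (y - 1)

/-- The extended `(p,q)`-confluent hypergeometric function
`Φ_{p,q}(β;γ;x) = (1/B(β,γ-β)) ∫₀¹ t^(β-1) (1-t)^(γ-β-1) exp(x t - p/t - q/(1-t)) dt`. -/
noncomputable def extPhi (p q β γ x : ℝ) : ℝ :=
  (1 / eulerBeta β (γ - β)) *
    ∫ t in (0:ℝ)..1, t ^ (β - 1) * (1 - t) ^ (γ - β - 1) * Real.exp (x * t - p / t - q / (1 - t))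

open MeasureTheory

/-- The Hölder inequality for real integrals, with exponents `a + b = 1`. -/
theorem integral_rpow_mul_rpow_le_s9 {Ω : Type*} [MeasurableSpace Ω] {μ : Measure Ω} {f g : Ω → ℝ}
    (hf : Integrable f μ) (hg : Integrable g μ) (hf₀ : 0 ≤ᵐ[μ] f) (hg₀ : 0 ≤ᵐ[μ] g)
    {a b : ℝ} (ha : 0 ≤ a) (hb : 0 ≤ b) (hab : a + b = 1) :
    ∫ t, f t ^ a * g t ^ b ∂μ ≤ (∫ t, f t ∂μ) ^ a * (∫ t, g t ∂μ) ^ b := by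
  have hm : AEStronglyMeasurable (fun t => f t ^ a * g t ^ b) μ :=
    ((hf.aemeasurable.pow_const a).mul (hg.aemeasurable.pow_const b)).aestronglyMeasurable
  have hpos : 0 ≤ᵐ[μ] fun t => f t ^ a * g t ^ b := by
    filter_upwards [hf₀, hg₀] with t h₁ h₂
    exact mul_nonneg (Real.rpow_nonneg h₁ a) (Real.rpow_nonneg h₂ b)
  have hF : 0 ≤ ∫ t, f t ∂μ := integral_nonneg_of_ae hf₀
  have hG : 0 ≤ ∫ t, g t ∂μ := integral_nonneg_of_ae hg₀
  rw [integral_eq_lintegral_of_nonneg_ae hpos hm]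
  refine ENNReal.toReal_le_of_le_ofReal (by positivity) ?_
  rw [ENNReal.ofReal_mul (by positivity), ← ENNReal.ofReal_rpow_of_nonneg hF ha,
    ← ENNReal.ofReal_rpow_of_nonneg hG hb, ofReal_integral_eq_lintegral_ofReal hf hf₀,
    ofReal_integral_eq_lintegral_ofReal hg hg₀]
  refine le_trans (le_of_eq (lintegral_congr_ae ?_))
    (ENNReal.lintegral_mul_norm_pow_le hf.aemeasurable.ennreal_ofReal
      hg.aemeasurable.ennreal_ofReal ha hb hab)
  filter_upwards [hf₀, hg₀] with t h₁ h₂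
  rw [ENNReal.ofReal_mul (Real.rpow_nonneg h₁ a), ENNReal.ofReal_rpow_of_nonneg h₁ ha,
    ENNReal.ofReal_rpow_of_nonneg h₂ hb]

theorem eulerBeta_nonneg (x y : ℝ) : 0 ≤ eulerBeta x y :=
  intervalIntegral.integral_nonneg zero_le_one fun _ ht =>
    mul_nonneg (Real.rpow_nonneg ht.1 _) (Real.rpow_nonneg (sub_nonneg.2 ht.2) _)

/-- The integrand of `extPhi`. -/
noncomputable def extPhiIntegrand (p q β γ x t : ℝ) : ℝ :=
  t ^ (β - 1) * (1 - t) ^ (γ - β - 1) * Real.exp (x * t - p / t - q / (1 - t))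

theorem extPhi_eq (p q β γ x : ℝ) :
    extPhi p q β γ x =
      (1 / eulerBeta β (γ - β)) * ∫ t in (0:ℝ)..1, extPhiIntegrand p q β γ x t :=
  rfl

theorem extPhiIntegrand_nonneg (p q β γ x : ℝ) {t : ℝ} (ht₀ : 0 ≤ t) (ht₁ : t ≤ 1) :
    0 ≤ extPhiIntegrand p q β γ x t :=
  mul_nonneg (mul_nonneg (Real.rpow_nonneg ht₀ _) (Real.rpow_nonneg (sub_nonneg.2 ht₁) _))
    (Real.exp_nonneg _)

theorem integral_extPhiIntegrand_nonneg (p q β γ x : ℝ) :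
    0 ≤ ∫ t in (0:ℝ)..1, extPhiIntegrand p q β γ x t :=
  intervalIntegral.integral_nonneg zero_le_one fun _ ht =>
    extPhiIntegrand_nonneg p q β γ x ht.1 ht.2

theorem intervalIntegrable_extPhiIntegrand_of {p q β γ z : ℝ}
    (h : IntervalIntegrable (extPhiIntegrand p q β γ z) volume 0 1) (x : ℝ) :
    IntervalIntegrable (extPhiIntegrand p q β γ x) volume 0 1 := by
  have hc : ContinuousOn (fun t : ℝ => Real.exp ((x - z) * t)) (Set.uIcc 0 1) := by fun_prop
  refine (h.mul_continuousOn hc).congr fun t _ => ?_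
  simp only [extPhiIntegrand]
  rw [mul_assoc, ← Real.exp_add]
  ring_nf

theorem extPhiIntegrand_convex_comb (p q β γ x y : ℝ) {a b t : ℝ} (ht₀ : 0 ≤ t) (ht₁ : t ≤ 1)
    (ha : 0 ≤ a) (hb : 0 ≤ b) (hab : a + b = 1) :
    extPhiIntegrand p q β γ (a * x + b * y) t =
      extPhiIntegrand p q β γ x t ^ a * extPhiIntegrand p q β γ y t ^ b := by
  simp only [extPhiIntegrand]
  set w := t ^ (β - 1) * (1 - t) ^ (γ - β - 1)
  have hw : 0 ≤ w :=
    mul_nonneg (Real.rpow_nonneg ht₀ _) (Real.rpow_nonneg (sub_nonneg.2 ht₁) _)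
  rw [Real.mul_rpow hw (Real.exp_nonneg _), Real.mul_rpow hw (Real.exp_nonneg _),
    mul_mul_mul_comm, ← Real.rpow_add_of_nonneg hw ha hb, hab, Real.rpow_one,
    ← Real.exp_mul, ← Real.exp_mul, ← Real.exp_add]
  congr 2
  linear_combination (-(p / t) - q / (1 - t)) * (-hab)

theorem integral_extPhiIntegrand_convex_comb_le (p q β γ x y : ℝ) {a b : ℝ}
    (ha : 0 ≤ a) (hb : 0 ≤ b) (hab : a + b = 1) :
    ∫ t in (0:ℝ)..1, extPhiIntegrand p q β γ (a * x + b * y) t ≤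
      (∫ t in (0:ℝ)..1, extPhiIntegrand p q β γ x t) ^ a *
        (∫ t in (0:ℝ)..1, extPhiIntegrand p q β γ y t) ^ b := by
  by_cases h : IntervalIntegrable (extPhiIntegrand p q β γ (a * x + b * y)) volume 0 1
  · have hi (z : ℝ) : IntegrableOn (extPhiIntegrand p q β γ z) (Set.Ioc 0 1) :=
      (intervalIntegrable_iff_integrableOn_Ioc_of_le zero_le_one).1
        (intervalIntegrable_extPhiIntegrand_of h z)
    have hpos (z : ℝ) : 0 ≤ᵐ[volume.restrict (Set.Ioc 0 1)] extPhiIntegrand p q β γ z :=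
      (ae_restrict_mem measurableSet_Ioc).mono fun _ ht =>
        extPhiIntegrand_nonneg p q β γ z ht.1.le ht.2
    simp only [intervalIntegral.integral_of_le zero_le_one]
    rw [setIntegral_congr_fun measurableSet_Ioc fun t ht =>
      extPhiIntegrand_convex_comb p q β γ x y ht.1.le ht.2 ha hb hab]
    exact integral_rpow_mul_rpow_le_s9 (hi x) (hi y) (hpos x) (hpos y) ha hb hab
  · rw [intervalIntegral.integral_undef h]
    exact mul_nonneg (Real.rpow_nonneg (integral_extPhiIntegrand_nonneg ..) _)
      (Real.rpow_nonneg (integral_extPhiIntegrand_nonneg ..) _)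

theorem extPhi_logConvex_in_x (p q β γ : ℝ) (hp : 0 < p) (hq : 0 < q)
    (hβ : 0 < β) (hγβ : β < γ) (x y α : ℝ) (hα₀ : 0 ≤ α) (hα₁ : α ≤ 1) :
    extPhi p q β γ (α * x + (1 - α) * y) ≤
      (extPhi p q β γ x) ^ α * (extPhi p q β γ y) ^ (1 - α) := by
  have hC : 0 ≤ 1 / eulerBeta β (γ - β) := one_div_nonneg.2 (eulerBeta_nonneg _ _)
  have hα : 0 ≤ 1 - α := sub_nonneg.2 hα₁
  simp only [extPhi_eq]
  rw [Real.mul_rpow hC (integral_extPhiIntegrand_nonneg ..),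
    Real.mul_rpow hC (integral_extPhiIntegrand_nonneg ..), mul_mul_mul_comm,
    ← Real.rpow_add_of_nonneg hC hα₀ hα, add_sub_cancel, Real.rpow_one]
  exact mul_le_mul_of_nonneg_left
    (integral_extPhiIntegrand_convex_comb_le p q β γ x y hα₀ hα (add_sub_cancel _ _)) hC
end
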